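/- Let k ≥ 1 and let T_k be the model completion of the theory in the vocabulary {P_0, …, P_k, R} (P_ℓ unary predicates, R a (k+1)-place predicate) whose models are exactly the structures M in which ⟨P^M_ℓ : ℓ ≤ k⟩ is a partition of the universe and R^M ⊆ {(a_0,…,a_k) : a_ℓ ∈ P^M_ℓ for ℓ = 0,…,k}. Then T_k exists, has elimination of quantifiers, the formula R(x, y_0, …, y_{k-1}) witnesses that T_k is k-independent, and T_k is (k+1)-dependent. -/

import Mathlib

open FirstOrder Cardinal Set

universe u

namespace Paper886

section Basic

variable (L : FirstOrder.Language.{u, u}) (M : Type u) [L.Structure M]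

/-- A first-order formula in `n` object variables together with a finite tuple of
parameters from `M`. -/
structure ParamFormula (n : ℕ) : Type u where
  m : ℕ
  toFormula : L.Formula (Fin n ⊕ Fin m)
  params : Fin m → M

variable {L M}

/-- Realization of a parametrized formula at a tuple. -/
def ParamFormula.Realize {n : ℕ} (f : ParamFormula L M n) (v : Fin n → M) : Prop :=
  f.toFormula.Realize (Sum.elim v f.params)

/-- The parameters of `f` all lie in `B`. -/
def ParamFormula.paramsIn {n : ℕ} (f : ParamFormula L M n) (B : Set M) : Prop :=
  ∀ i, f.params i ∈ B

/-- The set of realizations of a partial 1-type. -/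
def realizeSet (p : Set (ParamFormula L M 1)) : Set M :=
  {a | ∀ f ∈ p, f.Realize fun _ => a}

/-- The partial type `p` is over the parameter set `B`. -/
def IsTypeOver (p : Set (ParamFormula L M 1)) (B : Set M) : Prop :=
  ∀ f ∈ p, f.paramsIn B

variable (L) in
/-- Two tuples realize the same type over a set `A` of parameters. -/
def SameType {α : Type u} (A : Set M) (a b : α → M) : Prop :=
  ∀ (n mp : ℕ) (φ : L.Formula (Fin n ⊕ Fin mp)) (vs : Fin n → α) (ps : Fin mp → M),
    (∀ i, ps i ∈ A) →
      (φ.Realize (Sum.elim (fun i => a (vs i)) ps) ↔ φ.Realize (Sum.elim (fun i => b (vs i)) ps))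

variable (L M)

/-- `M` is `κ`-saturated: every finitely satisfiable 1-type over fewer than `κ`
parameters is realized in `M`. -/
def Saturated (κ : Cardinal.{u}) : Prop :=
  ∀ B : Set M, #B < κ → ∀ p : Set (ParamFormula L M 1), IsTypeOver p B →
    (∀ s : Set (ParamFormula L M 1), s ⊆ p → s.Finite → ∃ a : M, ∀ f ∈ s, f.Realize fun _ => a) →
    ∃ a : M, a ∈ realizeSet p

/-- `Th(M)` is dependent (NIP): no formula has the independence property, where consistency
of a pattern is rendered as finite satisfiability in the (saturated) monster. -/
def IsDependent : Prop :=
  ∀ (nx np : ℕ) (φ : L.Formula (Fin nx ⊕ Fin np)) (a : ℕ → Fin np → M),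
    ¬ ∀ (u : Set ℕ) (s : Finset ℕ), ∃ x : Fin nx → M,
        ∀ i ∈ s, (φ.Realize (Sum.elim x (a i)) ↔ i ∈ u)

variable {L M}

/-- The cardinality `|T|` of the (complete) theory of `M`. -/
noncomputable def theoryCard (L : FirstOrder.Language.{u, u}) : Cardinal.{u} :=
  ℵ₀ ⊔ L.card

variable (L M)

/-- A type-definable group: a partial type `p*` over `A*` together with definitions
(over `A*`) of the group operations making `p*(𝔠)` a group. -/
structure DefGroup : Type u where
  AStar : Set M
  pStar : Set (ParamFormula L M 1)
  pStar_over : IsTypeOver pStar AStar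
  mul : M → M → M
  inv : M → M
  one : M
  mul_definable : ∃ φ : ParamFormula L M 3, φ.paramsIn AStar ∧
    ∀ x y z : M, (φ.Realize ![x, y, z] ↔ mul x y = z)
  inv_definable : ∃ φ : ParamFormula L M 2, φ.paramsIn AStar ∧
    ∀ x y : M, (φ.Realize ![x, y] ↔ inv x = y)
  one_definable : ∃ φ : ParamFormula L M 1, φ.paramsIn AStar ∧
    ∀ x : M, (φ.Realize ![x] ↔ x = one)
  one_mem' : one ∈ realizeSet pStar
  mul_mem' : ∀ x ∈ realizeSet pStar, ∀ y ∈ realizeSet pStar, mul x y ∈ realizeSet pStar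
  inv_mem' : ∀ x ∈ realizeSet pStar, inv x ∈ realizeSet pStar
  mul_assoc' : ∀ x ∈ realizeSet pStar, ∀ y ∈ realizeSet pStar, ∀ z ∈ realizeSet pStar,
    mul (mul x y) z = mul x (mul y z)
  one_mul' : ∀ x ∈ realizeSet pStar, mul one x = x
  mul_one' : ∀ x ∈ realizeSet pStar, mul x one = x
  inv_mul' : ∀ x ∈ realizeSet pStar, mul (inv x) x = one
  mul_inv' : ∀ x ∈ realizeSet pStar, mul x (inv x) = one

variable {L M}

namespace DefGroup

variable (D : DefGroup L M)

/-- The underlying set of the group `G = p*(𝔠)`. -/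
def carrier : Set M := realizeSet D.pStar

/-- `G` is abelian. -/
def IsAbelian : Prop := ∀ x ∈ D.carrier, ∀ y ∈ D.carrier, D.mul x y = D.mul y x

/-- `H` is a subgroup of `G`. -/
def IsSubgroup (H : Set M) : Prop :=
  H ⊆ D.carrier ∧ D.one ∈ H ∧ (∀ x ∈ H, ∀ y ∈ H, D.mul x y ∈ H) ∧ ∀ x ∈ H, D.inv x ∈ H

/-- `(G : H) ≤ c`: at most `c` left cosets of `H` cover `G`. -/
def indexLE (H : Set M) (c : Cardinal.{u}) : Prop :=
  ∃ S : Set M, S ⊆ D.carrier ∧ #S ≤ c ∧ ∀ g ∈ D.carrier, ∃ s ∈ S, D.mul (D.inv s) g ∈ H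

/-- `(G : H) < c`: fewer than `c` left cosets of `H` cover `G`. -/
def indexLT (H : Set M) (c : Cardinal.{u}) : Prop :=
  ∃ S : Set M, S ⊆ D.carrier ∧ #S < c ∧ ∀ g ∈ D.carrier, ∃ s ∈ S, D.mul (D.inv s) g ∈ H

/-- The realization set of the partial type `q^n_Γ`. -/
def qSet (Γ : Set (ParamFormula L M 1)) (n : ℕ) : Set M :=
  {c | ∃ d : Fin n → M × M,
    (∀ ℓ, (d ℓ).1 ∈ D.carrier ∧ (d ℓ).2 ∈ D.carrier) ∧
    (∀ ℓ, ∀ f ∈ Γ, (f.Realize fun _ => (d ℓ).1) ↔ (f.Realize fun _ => (d ℓ).2)) ∧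
    c = (List.ofFn fun ℓ => D.mul (D.inv (d ℓ).1) (d ℓ).2).foldr D.mul D.one}

/-- The realization set of `q^n_{ā}`, i.e. `q^n_{Γ_ā}` where `Γ_ā` consists of all
formulas with parameters in the range of `ā`. -/
def qTupleSet {α : Type u} (a : α → M) (n : ℕ) : Set M :=
  D.qSet {f : ParamFormula L M 1 | f.paramsIn (Set.range a)} n

end DefGroup

end Basic

variable {L : FirstOrder.Language.{u, u}} {M : Type u} [L.Structure M]

variable (L) in
/-- `X` is the union of fewer than `κ` realization sets of types over `B`. -/
def UnionTypeDefOver (X B : Set M) (κ : Cardinal.{u}) : Prop :=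
  ∃ ι : Type u, #ι < κ ∧ ∃ P : ι → Set (ParamFormula L M 1),
    (∀ i, IsTypeOver (P i) B) ∧ X = ⋃ i, realizeSet (P i)

variable (L) in
/-- `X` is union-type-definable (with fewer than `κ` parameters altogether). -/
def UnionTypeDefinable (X : Set M) (κ : Cardinal.{u}) : Prop :=
  ∃ B : Set M, #B < κ ∧ UnionTypeDefOver L X B κ

/-- `G_q = (p* ∪ q)(𝔠)`. -/
def Gq (D : DefGroup L M) (q : Set (ParamFormula L M 1)) : Set M :=
  realizeSet (D.pStar ∪ q)

/-- `R_B`: the family of 1-types `q` over `B` such that `G_q` is a subgroup of `G`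
of index `< κ`. -/
def RB (D : DefGroup L M) (κ : Cardinal.{u}) (B : Set M) : Set (Set (ParamFormula L M 1)) :=
  {q | IsTypeOver q B ∧ D.IsSubgroup (Gq D q) ∧ D.indexLT (Gq D q) κ}

/-- `q_B`, the union of all members of `R_B`. -/
def qB (D : DefGroup L M) (κ : Cardinal.{u}) (B : Set M) : Set (ParamFormula L M 1) :=
  ⋃₀ RB D κ B

/-- `G_B = q_B(𝔠) ∩ G`. -/
def GB (D : DefGroup L M) (κ : Cardinal.{u}) (B : Set M) : Set M :=
  realizeSet (qB D κ B) ∩ D.carrier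

/-- The complete type of `a` over `A` (as the set of all param-formulas over `A`
satisfied by `a`). -/
def typeOf (A : Set M) (a : M) : Set (ParamFormula L M 1) :=
  {f | f.paramsIn A ∧ f.Realize fun _ => a}

/-- `φ(x̄, ȳ₀, …, ȳ_{k-1})` is `k`-independent: for every index set of size `< κ` there is
an array of parameter tuples such that every pattern on `^k ι` is (finitely) satisfiable. -/
def FormulaKIndep (M : Type u) [L.Structure M] (κ : Cardinal.{u}) (k nx : ℕ) (ny : Fin k → ℕ)
    (φ : L.Formula (Fin nx ⊕ ((ℓ : Fin k) × Fin (ny ℓ)))) : Prop :=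
  ∀ ι : Type u, #ι < κ →
    ∃ a : (ℓ : Fin k) → ι → Fin (ny ℓ) → M,
      ∀ (u : Set (Fin k → ι)) (s : Finset (Fin k → ι)),
        ∃ x : Fin nx → M,
          ∀ η ∈ s, ((φ.Realize (Sum.elim x fun p => a p.1 (η p.1) p.2)) ↔ η ∈ u)

/-- `Th(M)` is `k`-independent. -/
def KIndependent (L : FirstOrder.Language.{u, u}) (M : Type u) [L.Structure M] (κ : Cardinal.{u})
    (k : ℕ) : Prop :=
  ∃ (nx : ℕ) (ny : Fin k → ℕ) (φ : L.Formula (Fin nx ⊕ ((ℓ : Fin k) × Fin (ny ℓ)))),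
    FormulaKIndep M κ k nx ny φ

/-- `Th(M)` is `k`-dependent. -/
def KDependent (L : FirstOrder.Language.{u, u}) (M : Type u) [L.Structure M] (κ : Cardinal.{u})
    (k : ℕ) : Prop :=
  ¬ KIndependent L M κ k

/-- The language with unary predicates `P_0, …, P_k` and one `(k+1)`-place predicate `R`. -/
def pLang (k : ℕ) : FirstOrder.Language.{0, 0} where
  Functions := fun _ => Empty
  Relations := fun n => (Fin (k + 1) × PLift (n = 1)) ⊕ PLift (n = k + 1)

/-- The unary predicate symbols `P_ℓ`. -/
def pSym (k : ℕ) (ℓ : Fin (k + 1)) : (pLang k).Relations 1 := Sum.inl (ℓ, PLift.up rfl)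

/-- The `(k+1)`-place predicate symbol `R`. -/
def rSym (k : ℕ) : (pLang k).Relations (k + 1) := Sum.inr (PLift.up rfl)

/-- The axioms: `⟨P_ℓ : ℓ ≤ k⟩` is a partition of the universe and
`R ⊆ P_0 × ⋯ × P_k`. -/
def PAxiomsHold (k : ℕ) (N : Type u) [(pLang k).Structure N] : Prop :=
  (∀ x : N, ∃! ℓ : Fin (k + 1), Language.Structure.RelMap (pSym k ℓ) ![x]) ∧
  (∀ v : Fin (k + 1) → N, Language.Structure.RelMap (rSym k) v →
    ∀ ℓ : Fin (k + 1), Language.Structure.RelMap (pSym k ℓ) ![v ℓ])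

/-- `T1` is a model completion of `T0`: every model of `T1` models `T0`, every model of `T0`
embeds into a model of `T1`, `T1` is model complete (every embedding between models is
elementary), and `T1` has amalgamation over models of `T0`. -/
def IsModelCompletionOf {L : FirstOrder.Language.{0, 0}} (T0 T1 : L.Theory) : Prop :=
  (∀ N : Language.Theory.ModelType.{0, 0, u} T1, N.Carrier ⊨ T0) ∧
  (∀ N0 : Language.Theory.ModelType.{0, 0, u} T0,
    ∃ (N1 : Language.Theory.ModelType.{0, 0, u} T1) (_ : N0.Carrier ↪[L] N1.Carrier), True) ∧
  (∀ (N1 N2 : Language.Theory.ModelType.{0, 0, u} T1) (g : N1.Carrier ↪[L] N2.Carrier)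
      (n : ℕ) (φ : L.Formula (Fin n)) (v : Fin n → N1.Carrier),
    (φ.Realize fun i => g (v i)) ↔ φ.Realize v) ∧
  (∀ (N0 : Language.Theory.ModelType.{0, 0, u} T0) (N1 N2 : Language.Theory.ModelType.{0, 0, u} T1)
      (f1 : N0.Carrier ↪[L] N1.Carrier) (f2 : N0.Carrier ↪[L] N2.Carrier),
    ∃ (N : Language.Theory.ModelType.{0, 0, u} T1) (g1 : N1.Carrier ↪[L] N.Carrier)
      (g2 : N2.Carrier ↪[L] N.Carrier), ∀ x : N0.Carrier, g1 (f1 x) = g2 (f2 x))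

/-- `φ(x̄, ȳ_0, …, ȳ_{k-1})` is `k`-independent for the theory `T`: arbitrarily large finite
independent families exist in models of `T`. -/
def TheoryKIndepFormula {L : FirstOrder.Language.{0, 0}} (T : L.Theory) (k nx : ℕ)
    (ny : Fin k → ℕ) (φ : L.Formula (Fin nx ⊕ ((ℓ : Fin k) × Fin (ny ℓ)))) : Prop :=
  ∀ n : ℕ, ∃ (N : Language.Theory.ModelType.{0, 0, u} T)
      (a : (ℓ : Fin k) → Fin n → Fin (ny ℓ) → N.Carrier),
    ∀ u : Set (Fin k → Fin n), ∃ x : Fin nx → N.Carrier,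
      ∀ η : Fin k → Fin n, ((φ.Realize (Sum.elim x fun p => a p.1 (η p.1) p.2)) ↔ η ∈ u)

/-- The formula `R(x, y_0, …, y_{k-1})`. -/
def rFormula (k : ℕ) : (pLang k).Formula (Fin 1 ⊕ ((ℓ : Fin k) × Fin 1)) :=
  Language.Relations.formula (rSym k) fun i =>
    Language.Term.var (Fin.cases (Sum.inl (0 : Fin 1)) (fun j => Sum.inr ⟨j, (0 : Fin 1)⟩) i)

section Generic

open FirstOrder.Language FirstOrder.Language.Structure

variable {k : ℕ}

/-- `P_ℓ` holds of an element. -/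
abbrev InP (k : ℕ) {N : Type*} [(pLang k).Structure N] (ℓ : Fin (k + 1)) (x : N) : Prop :=
  RelMap (pSym k ℓ) ![x]

/-- `R` holds of a tuple. -/
abbrev InR (k : ℕ) {N : Type*} [(pLang k).Structure N] (v : Fin (k + 1) → N) : Prop :=
  RelMap (rSym k) v

/-- The semantic extension property characterizing the models of the model completion: over
every finite set `A`, each predicate `P_ℓ` has a new element whose `R`-relations with tuples
from `A` are prescribed by `U`. -/
def HasExtension (k : ℕ) (N : Type*) [(pLang k).Structure N] : Prop :=
  ∀ (ℓ : Fin (k + 1)) (A : Set N), A.Finite → ∀ U : Set (Fin k → N),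
    ∃ x : N, x ∉ A ∧ InP k ℓ x ∧ ∀ w : Fin k → N, (∀ j, w j ∈ A) →
      (∀ j, InP k (ℓ.succAbove j) (w j)) →
      (InR k (ℓ.insertNth (α := fun _ => N) x w) ↔ w ∈ U)

/-! ### Axioms -/

section Formulas

variable {α : Type*} {N : Type*} [(pLang k).Structure N]

/-- The atomic formula `P_ℓ(a)`. -/
def pAtom (ℓ : Fin (k + 1)) (a : α) : (pLang k).Formula α :=
  (pSym k ℓ).formula fun _ => Term.var a

/-- The atomic formula `R(η_0, …, η_k)`. -/
def rAtom (η : Fin (k + 1) → α) : (pLang k).Formula α :=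
  (rSym k).formula fun i => Term.var (η i)

/-- The atomic formula `a = b`. -/
def eqAtom (k : ℕ) (a b : α) : (pLang k).Formula α :=
  Term.equal (Term.var a) (Term.var b)

open Classical in
/-- The formula `φ` if `b` holds and its negation otherwise. -/
noncomputable def signed (b : Prop) (φ : (pLang k).Formula α) : (pLang k).Formula α :=
  if b then φ else φ.not

@[simp]
theorem realize_pAtom {ℓ : Fin (k + 1)} {a : α} {v : α → N} :
    (pAtom ℓ a).Realize v ↔ InP k ℓ (v a) := by
  rw [pAtom, Formula.realize_rel, iff_eq_eq]
  exact congrArg _ (funext fun i => by simp)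

@[simp]
theorem realize_rAtom {η : Fin (k + 1) → α} {v : α → N} :
    (rAtom η).Realize v ↔ InR k fun i => v (η i) := by
  simp [rAtom]

@[simp]
theorem realize_eqAtom {a b : α} {v : α → N} : (eqAtom k a b).Realize v ↔ v a = v b := by
  simp [eqAtom]

@[simp]
theorem realize_signed {b : Prop} {φ : (pLang k).Formula α} {v : α → N} :
    (signed b φ).Realize v ↔ (φ.Realize v ↔ b) := by
  by_cases hb : b <;> simp [signed, hb]

theorem isQF_pAtom (ℓ : Fin (k + 1)) (a : α) : (pAtom ℓ a).IsQF :=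
  (BoundedFormula.IsAtomic.rel _ _).isQF

theorem isQF_rAtom (η : Fin (k + 1) → α) : (rAtom η).IsQF :=
  (BoundedFormula.IsAtomic.rel _ _).isQF

theorem isQF_eqAtom (a b : α) : (eqAtom k a b).IsQF :=
  (BoundedFormula.IsAtomic.equal _ _).isQF

theorem isQF_signed {b : Prop} {φ : (pLang k).Formula α} (h : φ.IsQF) : (signed b φ).IsQF := by
  by_cases hb : b
  · simpa [signed, hb] using h
  · simpa [signed, hb] using h.not

end Formulas

theorem isQF_iInf {L' : FirstOrder.Language} {α β : Type*} [Finite β] {f : β → L'.Formula α}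
    (h : ∀ b, (f b).IsQF) : (Formula.iInf f).IsQF := by
  rw [Formula.iInf, BoundedFormula.iInf]
  generalize (@Finset.univ β (Fintype.ofFinite β)).toList = l
  induction l with
  | nil => exact BoundedFormula.IsQF.top
  | cons a l ih => exact (h a).inf ih

theorem isQF_iSup {L' : FirstOrder.Language} {α β : Type*} [Finite β] {f : β → L'.Formula α}
    (h : ∀ b, (f b).IsQF) : (Formula.iSup f).IsQF := by
  rw [Formula.iSup, BoundedFormula.iSup]
  generalize (@Finset.univ β (Fintype.ofFinite β)).toList = l
  induction l with
  | nil => exact BoundedFormula.isQF_bot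
  | cons a l ih => exact (h a).sup ih

/-- The sentence saying that the `P_ℓ` form a partition of the universe. -/
noncomputable def partitionAxiom (k : ℕ) : (pLang k).Sentence :=
  Formula.iAlls (Fin 1) <| Formula.iSup fun ℓ : Fin (k + 1) =>
    Formula.iInf fun ℓ' : Fin (k + 1) => signed (ℓ' = ℓ) (pAtom ℓ' (Sum.inr 0))

/-- The sentence saying that `R ⊆ P_0 × ⋯ × P_k`. -/
noncomputable def relationAxiom (k : ℕ) : (pLang k).Sentence :=
  Formula.iAlls (Fin (k + 1)) <|
    (rAtom Sum.inr).imp (Formula.iInf fun ℓ : Fin (k + 1) => pAtom ℓ (Sum.inr ℓ))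

/-- The instance of the extension property for sets of size `n`, the predicate `P_ℓ` and the
pattern `U`. -/
noncomputable def extensionAxiom (n : ℕ) (ℓ : Fin (k + 1)) (U : Set (Fin k → Fin n)) :
    (pLang k).Sentence :=
  Formula.iAlls (Fin n) <|
    (Formula.iInf fun i : Fin n => Formula.iInf fun j : Fin n =>
        signed (i = j) (eqAtom k (Sum.inr i) (Sum.inr j))).imp <|
    Formula.iExs (Fin 1) <|
      (pAtom ℓ (Sum.inr 0) ⊓
        Formula.iInf fun i : Fin n => (eqAtom k (Sum.inr 0) (Sum.inl (Sum.inr i))).not) ⊓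
      Formula.iInf fun w : Fin k → Fin n =>
        (Formula.iInf fun j : Fin k => pAtom (ℓ.succAbove j) (Sum.inl (Sum.inr (w j)))).imp <|
        signed (w ∈ U) <| rAtom <| ℓ.insertNth (α := fun _ => (Empty ⊕ Fin n) ⊕ Fin 1)
          (Sum.inr 0) fun j => Sum.inl (Sum.inr (w j))

/-- The theory of a partition `P_0, …, P_k` with a relation `R ⊆ P_0 × ⋯ × P_k`. -/
noncomputable def partitionTheory (k : ℕ) : (pLang k).Theory :=
  {partitionAxiom k, relationAxiom k}

/-- The model completion of `partitionTheory k`. -/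
noncomputable def genericTheory (k : ℕ) : (pLang k).Theory :=
  partitionTheory k ∪ {σ | ∃ n ℓ, ∃ U : Set (Fin k → Fin n), σ = extensionAxiom n ℓ U}

theorem model_partitionTheory_iff {N : Type u} [(pLang k).Structure N] :
    N ⊨ partitionTheory k ↔ PAxiomsHold k N := by
  simp only [partitionTheory, Theory.model_iff, Set.mem_insert_iff, Set.mem_singleton_iff,
    forall_eq_or_imp, forall_eq, Sentence.Realize, PAxiomsHold]
  refine and_congr ?_ ?_
  · rw [partitionAxiom, Formula.realize_iAlls]
    simp only [Formula.realize_iSup, Formula.realize_iInf, realize_signed, realize_pAtom]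
    refine ⟨fun h x => ?_, fun h x => ?_⟩
    · obtain ⟨ℓ, hℓ⟩ := h fun _ => x
      exact ⟨ℓ, (hℓ ℓ).2 rfl, fun ℓ' h' => (hℓ ℓ').1 h'⟩
    · obtain ⟨ℓ, h₁, h₂⟩ := h (x 0)
      exact ⟨ℓ, fun ℓ' => ⟨h₂ ℓ', fun h' => h' ▸ h₁⟩⟩
  · rw [relationAxiom, Formula.realize_iAlls]
    simp only [Formula.realize_imp, Formula.realize_iInf, realize_rAtom, realize_pAtom,
      Sum.elim_inr]

theorem realize_extensionAxiom {N : Type*} [(pLang k).Structure N] {n : ℕ} {ℓ : Fin (k + 1)}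
    {U : Set (Fin k → Fin n)} :
    N ⊨ extensionAxiom n ℓ U ↔ ∀ v : Fin n → N, Function.Injective v →
      ∃ x : N, (InP k ℓ x ∧ ∀ i, x ≠ v i) ∧ ∀ w : Fin k → Fin n,
        (∀ j, InP k (ℓ.succAbove j) (v (w j))) →
        (InR k (ℓ.insertNth (α := fun _ => N) x (v ∘ w)) ↔ w ∈ U) := by
  have key (v : Fin n → N) (x : Fin 1 → N) (w : Fin k → Fin n) :
      (fun i => Sum.elim (Sum.elim (default : Empty → N) v) x
        (ℓ.insertNth (α := fun _ => (Empty ⊕ Fin n) ⊕ Fin 1)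
          (Sum.inr 0) (fun j => Sum.inl (Sum.inr (w j))) i)) =
      ℓ.insertNth (α := fun _ => N) (x 0) (v ∘ w) := by
    funext i
    refine Fin.succAboveCases ℓ ?_ (fun j => ?_) i <;> simp
  rw [Sentence.Realize, extensionAxiom, Formula.realize_iAlls]
  simp only [Formula.realize_imp, Formula.realize_iInf, realize_signed, realize_eqAtom,
    Formula.realize_iExs, Formula.realize_inf, realize_pAtom, realize_rAtom, Formula.realize_not,
    Sum.elim_inr, Sum.elim_inl, key]
  refine forall_congr' fun v => imp_congr ?_ ?_
  · exact ⟨fun h i j hij => (h i j).1 hij, fun h i j => h.eq_iff⟩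
  · exact ⟨fun ⟨x, hx⟩ => ⟨x 0, hx⟩, fun ⟨x, hx⟩ => ⟨fun _ => x, hx⟩⟩

theorem hasExtension_iff {N : Type*} [(pLang k).Structure N] :
    HasExtension k N ↔ ∀ n ℓ (U : Set (Fin k → Fin n)), N ⊨ extensionAxiom n ℓ U := by
  simp only [realize_extensionAxiom]
  refine ⟨fun h n ℓ U v hv => ?_, fun h ℓ A hA U => ?_⟩
  · obtain ⟨x, hxA, hxP, hx⟩ := h ℓ (Set.range v) (Set.finite_range v) ((v ∘ ·) '' U)
    refine ⟨x, ⟨hxP, fun i hi => hxA ⟨i, hi.symm⟩⟩, fun w hw => ?_⟩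
    rw [hx (v ∘ w) (fun j => ⟨w j, rfl⟩) hw]
    exact hv.comp_left.mem_set_image
  · have := hA.to_subtype
    obtain ⟨n, ⟨e⟩⟩ := Finite.exists_equiv_fin A
    obtain ⟨x, ⟨hxP, hxA⟩, hx⟩ := h n ℓ {w | (fun j => (e.symm (w j) : N)) ∈ U}
      (fun i => e.symm i) (Subtype.val_injective.comp e.symm.injective)
    refine ⟨x, fun hxm => hxA (e ⟨x, hxm⟩) (by simp), hxP, fun w hwA hwP => ?_⟩
    have := hx (fun j => e ⟨w j, hwA j⟩) (by simpa using hwP)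
    simpa [Function.comp_def] using this

theorem model_genericTheory_iff {N : Type u} [(pLang k).Structure N] :
    N ⊨ genericTheory k ↔ PAxiomsHold k N ∧ HasExtension k N := by
  rw [genericTheory, Theory.model_union_iff, model_partitionTheory_iff, hasExtension_iff,
    Theory.model_iff]
  refine and_congr_right fun _ => ⟨fun h n ℓ U => h _ ⟨n, ℓ, U, rfl⟩, ?_⟩
  rintro h _ ⟨n, ℓ, U, rfl⟩
  exact h n ℓ U

/-! ### Quantifier elimination -/

theorem eq_cons_of_fin_one {α : Type*} (f : Fin 1 → α) : f = ![f 0] :=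
  funext fun i => by rw [Subsingleton.elim i 0]; rfl

theorem exists_eq_var {α : Type*} (t : (pLang k).Term α) : ∃ a, t = Term.var a := by
  cases t with
  | var a => exact ⟨a, rfl⟩
  | func f _ => exact f.elim

theorem sumElim_snoc_eq_comp {α N : Type*} {m : ℕ} (v : α → N) (xs : Fin m → N) (x : N) :
    Sum.elim v (Fin.snoc xs x : Fin (m + 1) → N) =
      (fun o : Option (α ⊕ Fin m) => o.elim x (Sum.elim v xs)) ∘
      Sum.elim (fun a => some (Sum.inl a))
        (Fin.snoc (fun i => some (Sum.inr i)) none : Fin (m + 1) → Option (α ⊕ Fin m)) := by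
  funext i
  rcases i with a | i
  · rfl
  · refine Fin.lastCases ?_ (fun j => ?_) i <;> simp

section SameAtoms

variable {I J : Type*} {N₁ N₂ : Type*} [(pLang k).Structure N₁] [(pLang k).Structure N₂]

/-- Two families of elements satisfy the same atomic formulas. -/
structure SameAtoms (k : ℕ) {I N₁ N₂ : Type*} [(pLang k).Structure N₁] [(pLang k).Structure N₂]
    (v₁ : I → N₁) (v₂ : I → N₂) : Prop where
  eq_iff : ∀ i j, v₁ i = v₁ j ↔ v₂ i = v₂ j
  inP_iff : ∀ ℓ i, InP k ℓ (v₁ i) ↔ InP k ℓ (v₂ i)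
  inR_iff : ∀ η : Fin (k + 1) → I, InR k (v₁ ∘ η) ↔ InR k (v₂ ∘ η)

namespace SameAtoms

variable {v₁ : I → N₁} {v₂ : I → N₂}

theorem symm (h : SameAtoms k v₁ v₂) : SameAtoms k v₂ v₁ :=
  ⟨fun i j => (h.eq_iff i j).symm, fun ℓ i => (h.inP_iff ℓ i).symm,
    fun η => (h.inR_iff η).symm⟩

theorem comp (h : SameAtoms k v₁ v₂) (f : J → I) : SameAtoms k (v₁ ∘ f) (v₂ ∘ f) :=
  ⟨fun _ _ => h.eq_iff _ _, fun ℓ _ => h.inP_iff ℓ _, fun η => h.inR_iff (f ∘ η)⟩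

theorem of_embedding (g : N₁ ↪[pLang k] N₂) (v : I → N₁) : SameAtoms k v (g ∘ v) :=
  ⟨fun _ _ => g.injective.eq_iff.symm, fun ℓ i => by
    refine (g.map_rel (pSym k ℓ) ![v i]).symm.trans (iff_of_eq (congrArg _ ?_))
    exact eq_cons_of_fin_one _, fun η => (g.map_rel (rSym k) (v ∘ η)).symm⟩

theorem relMap_iff (h : SameAtoms k v₁ v₂) {n : ℕ} (r : (pLang k).Relations n) (η : Fin n → I) :
    RelMap r (v₁ ∘ η) ↔ RelMap r (v₂ ∘ η) := by
  rcases r with ⟨ℓ, ⟨rfl⟩⟩ | ⟨⟨rfl⟩⟩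
  · rw [eq_cons_of_fin_one (v₁ ∘ η), eq_cons_of_fin_one (v₂ ∘ η)]
    exact h.inP_iff ℓ (η 0)
  · exact h.inR_iff η

theorem exists_extend [Finite I] (hN₁ : PAxiomsHold k N₁) (hN₂ : PAxiomsHold k N₂)
    (hE : HasExtension k N₂) (h : SameAtoms k v₁ v₂) (x₁ : N₁) :
    ∃ x₂ : N₂, SameAtoms k (fun o : Option I => o.elim x₁ v₁) (fun o => o.elim x₂ v₂) := by
  by_cases hx₁ : ∃ i, v₁ i = x₁
  · obtain ⟨i, rfl⟩ := hx₁
    refine ⟨v₂ i, ?_⟩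
    convert h.comp (fun o : Option I => o.elim i id) using 1 <;>
    · funext o
      cases o <;> rfl
  obtain ⟨ℓ, hℓ, hℓ'⟩ := hN₁.1 x₁
  obtain ⟨x₂, hxA, hxP, hxR⟩ := hE ℓ (Set.range v₂) (Set.finite_range v₂)
    {w | ∃ w' : Fin k → I, w = v₂ ∘ w' ∧ InR k (ℓ.insertNth (α := fun _ => N₁) x₁ (v₁ ∘ w'))}
  have hxℓ (ℓ') : InP k ℓ' x₁ ↔ InP k ℓ' x₂ :=
    ⟨fun h' => hℓ' _ h' ▸ hxP, fun h' => (hN₂.1 x₂).unique hxP h' ▸ hℓ⟩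
  refine ⟨x₂, ⟨?_, ?_, fun η => ?_⟩⟩
  · rintro (_ | i) (_ | j)
    · simp
    · exact iff_of_false (fun e => hx₁ ⟨j, e.symm⟩) (fun e => hxA ⟨j, e.symm⟩)
    · exact iff_of_false (fun e => hx₁ ⟨i, e⟩) (fun e => hxA ⟨i, e⟩)
    · exact h.eq_iff i j
  · rintro ℓ' (_ | i)
    · exact hxℓ ℓ'
    · exact h.inP_iff ℓ' i
  have hP (i) : InP k i (((η i).elim x₁ v₁ : N₁)) ↔ InP k i (((η i).elim x₂ v₂ : N₂)) := by
    cases η i with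
    | none => exact hxℓ i
    | some j => exact h.inP_iff i j
  by_cases hall : ∀ i, InP k i (((η i).elim x₁ v₁ : N₁))
  swap
  · exact iff_of_false (fun hR => hall (hN₁.2 _ hR))
      (fun hR => hall fun i => (hP i).2 (hN₂.2 _ hR i))
  have hsome (i) (hi : i ≠ ℓ) : ∃ j, η i = some j := by
    refine Option.ne_none_iff_exists'.1 fun e => hi (hℓ' _ ?_)
    simpa [e] using hall i
  choose w hw using fun j : Fin k => hsome (ℓ.succAbove j) (Fin.succAbove_ne ℓ j)
  cases hηℓ : η ℓ with
  | some i =>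
    have e : η = some ∘ ℓ.insertNth (α := fun _ => I) i w := by
      funext j
      refine Fin.succAboveCases ℓ ?_ (fun j => ?_) j
      · simp [hηℓ]
      · simp [hw]
    rw [e]
    exact h.inR_iff _
  | none =>
    have e₁ : (fun o : Option I => o.elim x₁ v₁) ∘ η =
        ℓ.insertNth (α := fun _ => N₁) x₁ (v₁ ∘ w) := by
      funext j
      refine Fin.succAboveCases ℓ ?_ (fun j => ?_) j
      · simp [hηℓ]
      · simp [hw]
    have e₂ : (fun o : Option I => o.elim x₂ v₂) ∘ η =
        ℓ.insertNth (α := fun _ => N₂) x₂ (v₂ ∘ w) := by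
      funext j
      refine Fin.succAboveCases ℓ ?_ (fun j => ?_) j
      · simp [hηℓ]
      · simp [hw]
    rw [e₁, e₂, hxR (v₂ ∘ w) (fun j => ⟨w j, rfl⟩)
      (fun j => by simpa [hw] using (hP (ℓ.succAbove j)).1 (hall _))]
    refine ⟨fun hR => ⟨w, rfl, hR⟩, ?_⟩
    rintro ⟨w', hw', hR⟩
    have : v₁ ∘ w = v₁ ∘ w' := funext fun j => (h.eq_iff _ _).2 (congrFun hw' j)
    rwa [this]

theorem realize_boundedFormula_iff {α : Type*} [Finite α]
    (hN₁ : PAxiomsHold k N₁) (hN₂ : PAxiomsHold k N₂)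
    (hE₁ : HasExtension k N₁) (hE₂ : HasExtension k N₂) {n : ℕ}
    (φ : (pLang k).BoundedFormula α n) : ∀ {v₁ : α → N₁} {v₂ : α → N₂}
    {xs₁ : Fin n → N₁} {xs₂ : Fin n → N₂}, SameAtoms k (Sum.elim v₁ xs₁) (Sum.elim v₂ xs₂) →
    (φ.Realize v₁ xs₁ ↔ φ.Realize v₂ xs₂) := by
  induction φ with
  | falsum => exact fun _ => Iff.rfl
  | equal t₁ t₂ =>
    intro v₁ v₂ xs₁ xs₂ h
    obtain ⟨a, rfl⟩ := exists_eq_var t₁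
    obtain ⟨b, rfl⟩ := exists_eq_var t₂
    exact h.eq_iff a b
  | rel r ts =>
    intro v₁ v₂ xs₁ xs₂ h
    choose η hη using fun i => exists_eq_var (ts i)
    obtain rfl : ts = fun i => Term.var (η i) := funext hη
    exact h.relMap_iff r η
  | imp φ ψ ihφ ihψ => exact fun h => imp_congr (ihφ h) (ihψ h)
  | @all m φ ih =>
    intro v₁ v₂ xs₁ xs₂ h
    simp only [BoundedFormula.realize_all]
    refine ⟨fun H x₂ => ?_, fun H x₁ => ?_⟩
    · obtain ⟨x₁, hx⟩ := h.symm.exists_extend hN₂ hN₁ hE₁ x₂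
      refine (ih ?_).1 (H x₁)
      rw [sumElim_snoc_eq_comp v₁, sumElim_snoc_eq_comp v₂]
      exact hx.symm.comp _
    · obtain ⟨x₂, hx⟩ := h.exists_extend hN₁ hN₂ hE₂ x₁
      refine (ih ?_).2 (H x₂)
      rw [sumElim_snoc_eq_comp v₁, sumElim_snoc_eq_comp v₂]
      exact hx.comp _

end SameAtoms

end SameAtoms

theorem SameAtoms.realize_iff {α : Type*} [Finite α]
    {N₁ N₂ : Theory.ModelType.{0, 0, u} (genericTheory k)} {v₁ : α → N₁} {v₂ : α → N₂}
    (h : SameAtoms k v₁ v₂) (φ : (pLang k).Formula α) : φ.Realize v₁ ↔ φ.Realize v₂ := by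
  obtain ⟨hN₁, hE₁⟩ := model_genericTheory_iff.1 N₁.is_model
  obtain ⟨hN₂, hE₂⟩ := model_genericTheory_iff.1 N₂.is_model
  refine realize_boundedFormula_iff hN₁ hN₂ hE₁ hE₂ φ ?_
  have key {N : Type u} (v : α → N) :
      Sum.elim v (default : Fin 0 → N) = v ∘ Sum.elim id finZeroElim := by
    funext i
    rcases i with a | i
    · rfl
    · exact i.elim0
  rw [key, key]
  exact h.comp _

theorem exists_isQF_realize_iff {α : Type*} [Finite α] (φ : (pLang k).Formula α) :
    ∃ ψ : (pLang k).Formula α, ψ.IsQF ∧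
      ∀ (N : Theory.ModelType.{0, 0, u} (genericTheory k)) (v : α → N),
        (φ.Realize v ↔ ψ.Realize v) := by
  let data {N : Type u} [(pLang k).Structure N] (v : α → N) :
      (α × α → Prop) × (Fin (k + 1) × α → Prop) × ((Fin (k + 1) → α) → Prop) :=
    (fun p => v p.1 = v p.2, fun p => InP k p.1 (v p.2), fun η => InR k fun i => v (η i))
  let χ (d : (α × α → Prop) × (Fin (k + 1) × α → Prop) × ((Fin (k + 1) → α) → Prop)) :
      (pLang k).Formula α :=
    ((Formula.iInf fun p : α × α => signed (d.1 p) (eqAtom k p.1 p.2)) ⊓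
      Formula.iInf fun p : Fin (k + 1) × α => signed (d.2.1 p) (pAtom p.1 p.2)) ⊓
      Formula.iInf fun η : Fin (k + 1) → α => signed (d.2.2 η) (rAtom η)
  have hχ {N : Type u} [(pLang k).Structure N] (v : α → N) (d) :
      (χ d).Realize v ↔ data v = d := by
    simp only [χ, data, Formula.realize_inf, Formula.realize_iInf, realize_signed,
      realize_eqAtom, realize_pAtom, realize_rAtom, Prod.ext_iff, funext_iff, and_assoc,
      eq_iff_iff]
  let S := {d | ∃ (N : Theory.ModelType.{0, 0, u} (genericTheory k)) (v : α → N),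
    data v = d ∧ φ.Realize v}
  refine ⟨Formula.iSup fun d : S => χ d, isQF_iSup fun d => ?_, fun N v => ?_⟩
  · exact ((isQF_iInf fun _ => isQF_signed (isQF_eqAtom _ _)).inf
      (isQF_iInf fun _ => isQF_signed (isQF_pAtom _ _))).inf
      (isQF_iInf fun _ => isQF_signed (isQF_rAtom _))
  · simp only [Formula.realize_iSup, hχ]
    refine ⟨fun h => ⟨⟨data v, N, v, rfl, h⟩, rfl⟩, ?_⟩
    rintro ⟨⟨d, N', v', hd, h'⟩, hv⟩
    have hdata : data v' = data v := hd.trans hv.symm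
    simp only [data, Prod.ext_iff, funext_iff, eq_iff_iff] at hdata
    refine (SameAtoms.realize_iff ?_ φ).1 h'
    exact ⟨fun i j => hdata.1 (i, j), fun ℓ i => hdata.2.1 (ℓ, i), hdata.2.2⟩

/-! ### Existence of models and amalgamation -/

/-- The structure with given interpretations of the `P_ℓ` and of `R`. -/
@[reducible]
def structureOf {N : Type*} (P : Fin (k + 1) → N → Prop) (R : (Fin (k + 1) → N) → Prop) :
    (pLang k).Structure N where
  funMap f := f.elim
  RelMap r v := match r with
    | Sum.inl (ℓ, h) => P ℓ (v ⟨0, h.down ▸ Nat.one_pos⟩)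
    | Sum.inr h => R fun i => v (Fin.cast h.down.symm i)

/-- An injective map preserving and reflecting the `P_ℓ` and `R` is an embedding. -/
def embeddingOf {N₁ N₂ : Type*} [(pLang k).Structure N₁] [(pLang k).Structure N₂] (f : N₁ → N₂)
    (hf : Function.Injective f) (hP : ∀ ℓ x, InP k ℓ (f x) ↔ InP k ℓ x)
    (hR : ∀ v, InR k (f ∘ v) ↔ InR k v) : N₁ ↪[pLang k] N₂ where
  toFun := f
  inj' := hf
  map_fun' g := g.elim
  map_rel' r v :=
    (show SameAtoms k f id from
      ⟨fun _ _ => hf.eq_iff, hP, hR⟩).relMap_iff r v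

theorem exists_surjective_code (k : ℕ) (N : Type u) : ∃ (Y : Type u)
    (g : Y → Fin (k + 1) × List (Fin k → N ⊕ Y) × ℕ), Function.Surjective g := by
  let Y := N ⊕ ULift.{u} ℕ
  have hY : ℵ₀ ≤ #Y := Cardinal.aleph0_le_mk Y
  have hX : #(N ⊕ Y) ≤ #Y := by
    rw [Cardinal.mk_sum, Cardinal.lift_id, Cardinal.lift_id]
    refine Cardinal.add_le_of_le hY ?_ le_rfl
    exact Cardinal.mk_le_of_injective Sum.inl_injective
  have hL : #(List (Fin k → N ⊕ Y)) ≤ #Y := by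
    refine (Cardinal.mk_list_le_max _).trans (max_le hY ?_)
    have hpow : #(Fin k → N ⊕ Y) = #(N ⊕ Y) ^ k := by simp
    rw [hpow]
    exact (Cardinal.power_le_power_right hX).trans (Cardinal.power_nat_le hY)
  have : #(Fin (k + 1) × List (Fin k → N ⊕ Y) × ℕ) ≤ #Y := by
    simp only [Cardinal.mk_prod, Cardinal.lift_uzero]
    refine Cardinal.mul_le_of_le hY ?_ (Cardinal.mul_le_of_le hY hL ?_)
    · exact (Cardinal.natCast_le_aleph0 (n := k + 1)).trans' (by simp) |>.trans hY
    · simp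
  obtain ⟨c⟩ := this
  exact ⟨Y, Function.invFun c, Function.invFun_surjective c.injective⟩

theorem exists_hasExtension_embedding {N : Type u} [(pLang k).Structure N]
    (hN : PAxiomsHold k N) : ∃ (N' : Type u) (_ : (pLang k).Structure N')
      (_ : N ↪[pLang k] N'), Nonempty N' ∧ PAxiomsHold k N' ∧ HasExtension k N' := by
  obtain ⟨Y, g, hg⟩ := exists_surjective_code k N
  let P (ℓ : Fin (k + 1)) : N ⊕ Y → Prop := Sum.elim (InP k ℓ) fun y => (g y).1 = ℓ
  let R (v : Fin (k + 1) → N ⊕ Y) : Prop := (∀ ℓ, P ℓ (v ℓ)) ∧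
    ((∃ w, v = Sum.inl ∘ w ∧ InR k w) ∨
      ∃ ℓ y, v ℓ = Sum.inr y ∧ (fun j => v (ℓ.succAbove j)) ∈ (g y).2.1)
  let S := structureOf P R
  have hP (ℓ) (x : N ⊕ Y) : InP k ℓ x ↔ P ℓ x := Iff.rfl
  have hR (v : Fin (k + 1) → N ⊕ Y) : InR k v ↔ R v := Iff.rfl
  refine ⟨N ⊕ Y, S, embeddingOf Sum.inl Sum.inl_injective (fun ℓ x => Iff.rfl) fun v => ?_,
    ⟨Sum.inr (hg (0, [], 0)).choose⟩, ⟨?_, fun v hv ℓ => (hP _ _).2 (hv.1 ℓ)⟩, ?_⟩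
  · rw [hR]
    constructor
    · rintro ⟨-, ⟨w, hw, hwR⟩ | ⟨ℓ, y, hy, -⟩⟩
      · rwa [show v = w from funext fun i => Sum.inl_injective (congrFun hw i)]
      · cases hy
    · exact fun h => ⟨hN.2 v h, Or.inl ⟨v, rfl, h⟩⟩
  · rintro (x | y)
    · exact hN.1 x
    · exact ⟨(g y).1, rfl, fun ℓ h => Eq.symm h⟩
  · intro ℓ A hA U
    have hBfin : {w : Fin k → N ⊕ Y | (∀ j, w j ∈ A) ∧ w ∈ U}.Finite :=
      (Set.Finite.pi' fun _ => hA).subset fun w hw => hw.1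
    let l := hBfin.toFinset.toList
    have hl (w) : w ∈ l ↔ (∀ j, w j ∈ A) ∧ w ∈ U := by simp [l]
    have hinf : (Set.range fun n : ℕ => Function.surjInv hg (ℓ, l, n)).Infinite :=
      Set.infinite_range_of_injective fun m n h => by
        simpa using Function.injective_surjInv hg h
    have hfin : (Sum.inr ⁻¹' A ∪ ⋃ y ∈ (Sum.inr ⁻¹' A : Set Y), ⋃ w ∈ {w | w ∈ (g y).2.1},
        Sum.inr ⁻¹' (Set.range w) : Set Y).Finite := by
      refine (hA.preimage Sum.inr_injective.injOn).union
        ((hA.preimage Sum.inr_injective.injOn).biUnion fun y _ =>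
          (List.finite_toSet _).biUnion fun w _ =>
            (Set.finite_range w).preimage Sum.inr_injective.injOn)
    obtain ⟨y, ⟨n, hn⟩, hy⟩ := (hinf.sdiff hfin).nonempty
    have hgy : g y = (ℓ, l, n) := by rw [← hn]; exact Function.surjInv_eq hg _
    simp only [Set.mem_union, Set.mem_iUnion, Set.mem_preimage, not_or, not_exists] at hy
    refine ⟨Sum.inr y, hy.1, (hP _ _).2 (congrArg Prod.fst hgy), fun w hwA hwP => ?_⟩
    rw [hR]
    constructor
    · rintro ⟨-, ⟨w', hw', -⟩ | ⟨ℓ', y', hy', hmem⟩⟩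
      · have := congrFun hw' ℓ
        simp at this
      · by_cases h : ℓ' = ℓ
        · subst h
          simp only [Fin.insertNth_apply_same, Sum.inr.injEq] at hy'
          subst hy'
          rw [hgy] at hmem
          simp only [Fin.insertNth_apply_succAbove] at hmem
          exact ((hl w).1 hmem).2
        · obtain ⟨j, rfl⟩ := Fin.exists_succAbove_eq h
          obtain ⟨i, hi⟩ := Fin.exists_succAbove_eq (Ne.symm h)
          rw [Fin.insertNth_apply_succAbove] at hy'
          refine absurd ⟨i, ?_⟩ (hy.2 y' (hy' ▸ hwA j) _ hmem)
          simp [hi]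
    · intro hwU
      refine ⟨fun i => ?_, Or.inr ⟨ℓ, y, by simp, ?_⟩⟩
      · refine Fin.succAboveCases ℓ ?_ (fun j => ?_) i
        · simpa [P] using congrArg Prod.fst hgy
        · simpa using (hP _ _).1 (hwP j)
      · rw [hgy]
        simpa using (hl w).2 ⟨hwA, hwU⟩

theorem exists_generic_embedding {N : Type u} [(pLang k).Structure N] (hN : PAxiomsHold k N) :
    ∃ (N' : Theory.ModelType.{0, 0, u} (genericTheory k)) (_ : N ↪[pLang k] N'), True := by
  obtain ⟨N', S, g, hne, hP, hE⟩ := exists_hasExtension_embedding hN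
  have : N' ⊨ genericTheory k := model_genericTheory_iff.2 ⟨hP, hE⟩
  exact ⟨Theory.ModelType.of _ N', g, trivial⟩

theorem exists_amalgam {N₀ N₁ N₂ : Type u} [(pLang k).Structure N₀] [(pLang k).Structure N₁]
    [(pLang k).Structure N₂] (hN₁ : PAxiomsHold k N₁) (hN₂ : PAxiomsHold k N₂)
    (f₁ : N₀ ↪[pLang k] N₁) (f₂ : N₀ ↪[pLang k] N₂) :
    ∃ (N : Type u) (_ : (pLang k).Structure N) (g₁ : N₁ ↪[pLang k] N) (g₂ : N₂ ↪[pLang k] N),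
      PAxiomsHold k N ∧ ∀ x, g₁ (f₁ x) = g₂ (f₂ x) := by
  classical
  let N := N₁ ⊕ {y : N₂ // y ∉ Set.range f₂}
  let g₁ : N₁ → N := Sum.inl
  let g₂ (y : N₂) : N := if h : y ∈ Set.range f₂ then Sum.inl (f₁ h.choose) else Sum.inr ⟨y, h⟩
  have hg₂f (x) : g₂ (f₂ x) = Sum.inl (f₁ x) := by
    have h : f₂ x ∈ Set.range f₂ := ⟨x, rfl⟩
    simp only [g₂, dif_pos h]
    rw [f₂.injective h.choose_spec]
  have hg₂n (y) (h : y ∉ Set.range f₂) : g₂ y = Sum.inr ⟨y, h⟩ := dif_neg h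
  have hg₁₂ {x y} (h : g₁ x = g₂ y) : ∃ z, x = f₁ z ∧ y = f₂ z := by
    by_cases hy : y ∈ Set.range f₂
    · obtain ⟨z, rfl⟩ := hy
      rw [hg₂f] at h
      exact ⟨z, Sum.inl_injective h, rfl⟩
    · rw [hg₂n y hy] at h
      cases h
  have hinj : Function.Injective g₂ := by
    intro y y' h
    by_cases hy : y ∈ Set.range f₂
    · obtain ⟨z, rfl⟩ := hy
      rw [hg₂f] at h
      obtain ⟨z', hz, rfl⟩ := hg₁₂ h
      rw [f₁.injective hz]
    · by_cases hy' : y' ∈ Set.range f₂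
      · obtain ⟨z, rfl⟩ := hy'
        rw [hg₂f] at h
        obtain ⟨z', hz, rfl⟩ := hg₁₂ h.symm
        rw [f₁.injective hz]
      · rw [hg₂n y hy, hg₂n y' hy'] at h
        exact congrArg Subtype.val (Sum.inr_injective h)
  let P (ℓ : Fin (k + 1)) : N → Prop := Sum.elim (InP k ℓ) fun y => InP k ℓ y.1
  let R (v : Fin (k + 1) → N) : Prop :=
    (∃ w, v = g₁ ∘ w ∧ InR k w) ∨ ∃ w, v = g₂ ∘ w ∧ InR k w
  let S := structureOf P R
  have hP (ℓ) (x : N) : InP k ℓ x ↔ P ℓ x := Iff.rfl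
  have hR (v : Fin (k + 1) → N) : InR k v ↔ R v := Iff.rfl
  have hf₁ := SameAtoms.of_embedding f₁ id
  have hf₂ := SameAtoms.of_embedding f₂ id
  have hPg₂ (ℓ y) : InP k ℓ (g₂ y) ↔ InP k ℓ y := by
    by_cases hy : y ∈ Set.range f₂
    · obtain ⟨z, rfl⟩ := hy
      rw [hg₂f]
      exact (hf₁.inP_iff ℓ z).symm.trans (hf₂.inP_iff ℓ z)
    · rw [hg₂n y hy]
      exact Iff.rfl
  have hglue {w₁ : Fin (k + 1) → N₁} {w₂ : Fin (k + 1) → N₂} (h : g₁ ∘ w₁ = g₂ ∘ w₂) :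
      InR k w₁ ↔ InR k w₂ := by
    choose z hz₁ hz₂ using fun i => hg₁₂ (congrFun h i)
    obtain rfl : w₁ = f₁ ∘ z := funext hz₁
    obtain rfl : w₂ = f₂ ∘ z := funext hz₂
    exact (hf₁.inR_iff z).symm.trans (hf₂.inR_iff z)
  refine ⟨N, S, embeddingOf g₁ Sum.inl_injective (fun ℓ x => Iff.rfl) fun v => ?_,
    embeddingOf g₂ hinj hPg₂ fun v => ?_, ⟨?_, ?_⟩, fun x => (hg₂f x).symm⟩
  · rw [hR]
    constructor
    · rintro (⟨w, hw, h⟩ | ⟨w, hw, h⟩)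
      · rwa [show v = w from funext fun i => Sum.inl_injective (congrFun hw i)]
      · exact (hglue hw).2 h
    · exact fun h => Or.inl ⟨v, rfl, h⟩
  · rw [hR]
    constructor
    · rintro (⟨w, hw, h⟩ | ⟨w, hw, h⟩)
      · exact (hglue hw.symm).1 h
      · rwa [show v = w from funext fun i => hinj (congrFun hw i)]
    · exact fun h => Or.inr ⟨v, rfl, h⟩
  · rintro (x | y)
    · exact hN₁.1 x
    · exact hN₂.1 y.1
  · intro v hv ℓ
    obtain ⟨w, rfl, h⟩ | ⟨w, rfl, h⟩ := (hR v).1 hv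
    · exact hN₁.2 w h ℓ
    · exact (hPg₂ ℓ (w ℓ)).2 (hN₂.2 w h ℓ)

theorem isModelCompletionOf_genericTheory :
    IsModelCompletionOf.{u} (partitionTheory k) (genericTheory k) := by
  refine ⟨fun N => N.is_model.mono Set.subset_union_left, fun N₀ => ?_, ?_, ?_⟩
  · exact exists_generic_embedding (model_partitionTheory_iff.1 N₀.is_model)
  · exact fun N₁ N₂ g n φ v => ((SameAtoms.of_embedding g v).realize_iff φ).symm
  · intro N₀ N₁ N₂ f₁ f₂
    obtain ⟨N, S, g₁, g₂, hN, hg⟩ := exists_amalgam (model_genericTheory_iff.1 N₁.is_model).1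
      (model_genericTheory_iff.1 N₂.is_model).1 f₁ f₂
    obtain ⟨N', g, -⟩ := exists_generic_embedding hN
    exact ⟨N', g.comp g₁, g.comp g₂, fun x => by simp [hg]⟩

/-! ### Independence and dependence -/

theorem HasExtension.infinite_inP {N : Type*} [(pLang k).Structure N] (hN : HasExtension k N)
    (ℓ : Fin (k + 1)) : {x : N | InP k ℓ x}.Infinite := by
  intro hfin
  obtain ⟨x, hx, hxP, -⟩ := hN ℓ _ hfin ∅
  exact hx hxP

theorem exists_genericTheory_model (k : ℕ) :
    Nonempty (Theory.ModelType.{0, 0, u} (genericTheory k)) := by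
  let S := structureOf (k := k) (N := PUnit.{u + 1}) (fun ℓ _ => ℓ = 0) fun _ => False
  have hS : PAxiomsHold k PUnit.{u + 1} :=
    ⟨fun _ => ⟨0, rfl, fun _ h => h⟩, fun _ h => h.elim⟩
  obtain ⟨N, -⟩ := exists_generic_embedding hS
  exact ⟨N⟩

theorem theoryKIndepFormula_rFormula (k : ℕ) :
    TheoryKIndepFormula.{u} (genericTheory k) k 1 (fun _ => 1) (rFormula k) := by
  intro n
  obtain ⟨N⟩ := exists_genericTheory_model.{u} k
  obtain ⟨-, hE⟩ := model_genericTheory_iff.1 N.is_model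
  let b (j : Fin k) (i : Fin n) : N := (hE.infinite_inP j.succ).natEmbedding _ i
  have hbP (j i) : InP k j.succ (b j i) := ((hE.infinite_inP j.succ).natEmbedding _ i).2
  have hb (j) : Function.Injective (b j) :=
    Subtype.val_injective.comp <|
      ((hE.infinite_inP j.succ).natEmbedding _).injective.comp Fin.val_injective
  refine ⟨N, fun j i _ => b j i, fun u => ?_⟩
  obtain ⟨x, -, -, hx⟩ := hE 0 (Set.range fun p : Fin k × Fin n => b p.1 p.2)
    (Set.finite_range _) ((fun (η : Fin k → Fin n) j => b j (η j)) '' u)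
  refine ⟨fun _ => x, fun η => ?_⟩
  have := hx (fun j => b j (η j)) (fun j => ⟨(j, η j), rfl⟩) (fun j => by simpa using hbP j (η j))
  have hinj : Function.Injective fun (η : Fin k → Fin n) j => b j (η j) :=
    fun η η' h => funext fun j => hb j (congrFun h j)
  rw [hinj.mem_set_image] at this
  rw [← this, rFormula, Formula.realize_rel, iff_eq_eq]
  refine congrArg _ (funext fun i => ?_)
  refine Fin.cases ?_ (fun j => ?_) i <;> simp

/-- The index set of the atomic facts about an `m`-tuple `x` over a family indexed by `J`. -/
abbrev AtomIndex (k m : ℕ) (J : Type) : Type :=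
  (Fin m × (Fin m ⊕ J)) ⊕ (Fin (k + 1) × Fin m) ⊕
    (Fin (k + 1) × Fin m × (Fin k → Fin m ⊕ J))

/-- The truth values of the atomic facts about a tuple `x` over a family `b`. -/
def atomData {N : Type*} [(pLang k).Structure N] {m : ℕ} {J : Type} (x : Fin m → N)
    (b : J → N) : AtomIndex k m J → Prop
  | Sum.inl (i, j) => x i = Sum.elim x b j
  | Sum.inr (Sum.inl (ℓ, i)) => InP k ℓ (x i)
  | Sum.inr (Sum.inr (ℓ, i, w)) => InR k (ℓ.insertNth (α := fun _ => N) (x i) (Sum.elim x b ∘ w))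

theorem sameAtoms_of_atomData_eq {N : Type*} [(pLang k).Structure N] {m : ℕ} {J : Type}
    {x x' : Fin m → N} {b : J → N} (h : atomData (k := k) x b = atomData x' b) :
    SameAtoms k (Sum.elim x b) (Sum.elim x' b) := by
  have heq (i j) : x i = Sum.elim x b j ↔ x' i = Sum.elim x' b j :=
    iff_of_eq (congrFun h (Sum.inl (i, j)))
  refine ⟨?_, ?_, fun η => ?_⟩
  · rintro (i | i) (j | j)
    · exact heq i (Sum.inl j)
    · exact heq i (Sum.inr j)
    · exact eq_comm.trans ((heq j (Sum.inr i)).trans eq_comm)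
    · rfl
  · rintro ℓ (i | i)
    · exact iff_of_eq (congrFun h (Sum.inr (Sum.inl (ℓ, i))))
    · rfl
  · by_cases hη : ∃ ℓ i, η ℓ = Sum.inl i
    · obtain ⟨ℓ, i, hi⟩ := hη
      have key (y : Fin m → N) : Sum.elim y b ∘ η =
          ℓ.insertNth (α := fun _ => N) (y i) (Sum.elim y b ∘ fun j => η (ℓ.succAbove j)) := by
        funext i
        refine Fin.succAboveCases ℓ ?_ (fun j => ?_) i <;> simp [hi]
      rw [key, key]
      exact iff_of_eq (congrFun h (Sum.inr (Sum.inr (ℓ, i, fun j => η (ℓ.succAbove j)))))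
    · have : Sum.elim x b ∘ η = Sum.elim x' b ∘ η := by
        funext ℓ
        rcases hℓ : η ℓ with i | j
        · exact absurd ⟨ℓ, i, hℓ⟩ hη
        · simp [hℓ]
      rw [this]

theorem card_atomIndex (k m : ℕ) (J : Type) [Fintype J] :
    Fintype.card (AtomIndex k m J) = m * (m + Fintype.card J) +
      ((k + 1) * m + (k + 1) * (m * (m + Fintype.card J) ^ k)) := by
  simp [AtomIndex]

theorem exists_card_atomIndex_lt (hk : 1 ≤ k) (m s : ℕ) : ∃ n : ℕ,
    m * (m + n * s) + ((k + 1) * m + (k + 1) * (m * (m + n * s) ^ k)) < n ^ (k + 1) := by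
  let C := m * (m + s) + ((k + 1) * m + (k + 1) * (m * (m + s) ^ k))
  refine ⟨C + 1, ?_⟩
  generalize hn : C + 1 = n
  have hn1 : 1 ≤ n := by omega
  have hnk : n ≤ n ^ k := Nat.le_self_pow (by omega) n
  have hms : m + n * s ≤ n * (m + s) := by nlinarith
  calc m * (m + n * s) + ((k + 1) * m + (k + 1) * (m * (m + n * s) ^ k))
      ≤ m * (n * (m + s)) + ((k + 1) * m + (k + 1) * (m * (n * (m + s)) ^ k)) := by gcongr
    _ ≤ m * (n ^ k * (m + s)) + ((k + 1) * m * n ^ k + (k + 1) * (m * (n * (m + s)) ^ k)) := by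
        have hle : (k + 1) * m ≤ (k + 1) * m * n ^ k := Nat.le_mul_of_pos_right _ (hn1.trans hnk)
        exact Nat.add_le_add (by gcongr) (Nat.add_le_add_right hle _)
    _ = C * n ^ k := by rw [mul_pow]; simp only [C]; ring
    _ < n * n ^ k := by
        exact Nat.mul_lt_mul_of_pos_right (by omega) (hn1.trans hnk)
    _ = n ^ (k + 1) := by ring

theorem not_theoryKIndepFormula_succ (hk : 1 ≤ k) {m : ℕ} {ny : Fin (k + 1) → ℕ}
    (φ : (pLang k).Formula (Fin m ⊕ ((ℓ : Fin (k + 1)) × Fin (ny ℓ)))) :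
    ¬ TheoryKIndepFormula.{u} (genericTheory k) (k + 1) m ny φ := by
  classical
  intro h
  obtain ⟨n, hn⟩ := exists_card_atomIndex_lt hk m (∑ ℓ, ny ℓ)
  obtain ⟨N, a, ha⟩ := h n
  choose x hx using ha
  let J := (ℓ : Fin (k + 1)) × (Fin n × Fin (ny ℓ))
  let b (p : J) : N := a p.1 p.2.1 p.2.2
  have hinj : Function.Injective fun u => atomData (k := k) (x u) b := by
    intro u u' huu'
    ext η
    rw [← hx u η, ← hx u' η]
    refine SameAtoms.realize_iff ?_ φ
    have key (y : Fin m → N) : Sum.elim y (fun p : (ℓ : Fin (k + 1)) × Fin (ny ℓ) =>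
        a p.1 (η p.1) p.2) = Sum.elim y b ∘ Sum.map id (fun p => ⟨p.1, η p.1, p.2⟩) := by
      funext i
      rcases i with i | i <;> rfl
    rw [key, key]
    exact (sameAtoms_of_atomData_eq huu').comp _
  have hcard := Fintype.card_le_of_injective _ hinj
  have hJ : Fintype.card J = n * ∑ ℓ, ny ℓ := by
    simp [J, Finset.mul_sum]
  simp only [Fintype.card_set, Fintype.card_fun, Fintype.card_prop, Fintype.card_fin,
    card_atomIndex, hJ] at hcard
  exact absurd ((Nat.pow_le_pow_iff_right (by norm_num)).1 hcard) (not_le.2 hn)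

end Generic

/-- Example 2.8 of [Sh:886]: the theory of a partition `P_0, …, P_k` with a `(k+1)`-ary
relation `R ⊆ P_0 × ⋯ × P_k` has a model completion `T_k`; `T_k` has elimination of
quantifiers, the formula `R(x, y_0, …, y_{k-1})` witnesses that `T_k` is `k`-independent,
and `T_k` is `(k+1)`-dependent. -/
theorem example_dt23 (k : ℕ) (hk : 1 ≤ k) :
    ∃ T0 T1 : (pLang k).Theory,
      (∀ (N : Type u) [(pLang k).Structure N], (N ⊨ T0) ↔ PAxiomsHold k N) ∧
      IsModelCompletionOf.{u} T0 T1 ∧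
      (∀ (n : ℕ) (φ : (pLang k).Formula (Fin n)), ∃ ψ : (pLang k).Formula (Fin n),
        ψ.IsQF ∧ ∀ (N : Language.Theory.ModelType.{0, 0, u} T1) (v : Fin n → N.Carrier),
          (φ.Realize v ↔ ψ.Realize v)) ∧
      TheoryKIndepFormula.{u} T1 k 1 (fun _ => 1) (rFormula k) ∧
      (¬ ∃ (nx : ℕ) (ny : Fin (k + 1) → ℕ)
          (φ : (pLang k).Formula (Fin nx ⊕ ((ℓ : Fin (k + 1)) × Fin (ny ℓ)))),
        TheoryKIndepFormula.{u} T1 (k + 1) nx ny φ) := by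
  exact ⟨partitionTheory k, genericTheory k, fun N _ => model_partitionTheory_iff,
    isModelCompletionOf_genericTheory, fun n φ => exists_isQF_realize_iff φ,
    theoryKIndepFormula_rFormula k, fun ⟨_, _, φ, h⟩ => not_theoryKIndepFormula_succ hk φ h⟩

end Paper886
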